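/- Let A, B ⊆ R² be two closed convex cones whose intersection contains more than one point. Then there exists n ∈ N such that for every starting point x₀ ∈ R², the n-th Douglas–Rachford iterate T_DR^n(x₀) is a fixed point of T_DR. -/

import Mathlib

open Filter Topology Set

/-- The Euclidean plane. -/
abbrev Plane := EuclideanSpace ℝ (Fin 2)

namespace Plane

/-- Rotation by a right angle. -/
noncomputable def rot (x : Plane) : Plane := !₂[-x 1, x 0]

/-- The signed area spanned by two vectors. -/
def area (x y : Plane) : ℝ := x 0 * y 1 - x 1 * y 0

@[simp] lemma rot_zero_coord (x : Plane) : rot x 0 = -x 1 := rfl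

@[simp] lemma rot_one_coord (x : Plane) : rot x 1 = x 0 := rfl

lemma inner_eq (x y : Plane) : inner ℝ x y = x 0 * y 0 + x 1 * y 1 := by
  simp [PiLp.inner_apply, Fin.sum_univ_two, mul_comm]

lemma norm_sq_eq (x : Plane) : ‖x‖ ^ 2 = x 0 ^ 2 + x 1 ^ 2 := by
  rw [← real_inner_self_eq_norm_sq, inner_eq]; ring

lemma ext_coord {x y : Plane} (h0 : x 0 = y 0) (h1 : x 1 = y 1) : x = y := by
  ext i; fin_cases i <;> assumption

lemma sq_add_sq_pos {x : Plane} (hx : x ≠ 0) : 0 < x 0 ^ 2 + x 1 ^ 2 := by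
  rw [← norm_sq_eq]; positivity

/-- A unit vector `e` defines the orthogonal projection onto the line it spans. -/
noncomputable def lineProj (e : Plane) : Plane →ₗ[ℝ] Plane :=
  (innerₛₗ ℝ e).smulRight e

@[simp] lemma lineProj_apply (e x : Plane) : lineProj e x = (inner ℝ e x : ℝ) • e := rfl

/-- The linear maps which occur as pieces of a planar Douglas–Rachford operator: similarities
`cos θ • Rot θ` (including `0` and the identity) and orthogonal projections onto lines. -/
def IsPiece (L : Plane →ₗ[ℝ] Plane) : Prop :=
  (∃ a b : ℝ, a ^ 2 + b ^ 2 = a ∧ ∀ y, L y = a • y + b • rot y) ∨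
    ∃ e : Plane, e 0 ^ 2 + e 1 ^ 2 = 1 ∧ ∀ y, L y = (inner ℝ e y : ℝ) • e

/-- The linear maps which occur as pieces of the projection onto a planar convex cone. -/
def IsProjPiece (L : Plane →ₗ[ℝ] Plane) : Prop :=
  L = 0 ∨ L = LinearMap.id ∨ ∃ e : Plane, e 0 ^ 2 + e 1 ^ 2 = 1 ∧ L = lineProj e

lemma IsPiece.zero_or_fixed {L : Plane →ₗ[ℝ] Plane} (hL : IsPiece L) {z : Plane}
    (hz : z ≠ 0) (h : area z (L z) = 0) : L z = 0 ∨ L z = z := by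
  have hz' := sq_add_sq_pos hz
  rcases hL with ⟨a, b, hab, hL⟩ | ⟨e, he, hL⟩
  · rw [hL] at h ⊢
    simp only [area, PiLp.add_apply, PiLp.smul_apply, smul_eq_mul, rot_zero_coord,
      rot_one_coord] at h
    have hb : b = 0 := by
      have : b * (z 0 ^ 2 + z 1 ^ 2) = 0 := by linarith
      rcases mul_eq_zero.1 this with h | h
      · exact h
      · exact absurd h hz'.ne'
    subst hb
    have : a * (a - 1) = 0 := by nlinarith
    rcases mul_eq_zero.1 this with h | h
    · left; simp [h]
    · right; simp [show a = 1 by linarith]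
  · rw [hL] at h ⊢
    simp only [area, PiLp.smul_apply, smul_eq_mul] at h
    have h' : (inner ℝ e z : ℝ) * (z 0 * e 1 - z 1 * e 0) = 0 := by linarith
    rcases mul_eq_zero.1 h' with h | h
    · left; simp [h]
    · right
      rw [inner_eq]
      apply ext_coord <;> simp only [PiLp.smul_apply, smul_eq_mul]
      · linear_combination z 0 * he - e 1 * h
      · linear_combination z 1 * he + e 0 * h

lemma IsPiece.of_fixed {L : Plane →ₗ[ℝ] Plane} (hL : IsPiece L) {z : Plane}
    (hz : z ≠ 0) (h : L z = z) (y : Plane) :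
    L y = y ∨ L y = ((inner ℝ z y : ℝ) / (z 0 ^ 2 + z 1 ^ 2)) • z := by
  have hz' := sq_add_sq_pos hz
  rcases hL with ⟨a, b, hab, hL⟩ | ⟨e, he, hL⟩
  · left
    rw [hL] at h ⊢
    have h0 := congrArg (fun v : Plane => v 0) h
    have h1 := congrArg (fun v : Plane => v 1) h
    simp only [PiLp.add_apply, PiLp.smul_apply, smul_eq_mul, rot_zero_coord,
      rot_one_coord] at h0 h1
    have hb : b = 0 := by
      have : b * (z 0 ^ 2 + z 1 ^ 2) = 0 := by linear_combination z 0 * h1 - z 1 * h0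
      exact (mul_eq_zero.1 this).resolve_right hz'.ne'
    have ha : a - 1 = 0 := by
      have : (a - 1) * (z 0 ^ 2 + z 1 ^ 2) = 0 := by linear_combination z 0 * h0 + z 1 * h1
      exact (mul_eq_zero.1 this).resolve_right hz'.ne'
    simp [hb, show a = 1 by linarith]
  · right
    rw [hL] at h ⊢
    generalize hk : (inner ℝ e z : ℝ) = k at h
    have hk0 : k ≠ 0 := by rintro rfl; simp at h; exact hz h.symm
    subst h
    rw [real_inner_smul_left, smul_smul]
    congr 1
    simp only [PiLp.smul_apply, smul_eq_mul]
    have : (k * e 0) ^ 2 + (k * e 1) ^ 2 = k ^ 2 := by linear_combination k ^ 2 * he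
    rw [this]; field_simp

lemma IsPiece.of_zero {L : Plane →ₗ[ℝ] Plane} (hL : IsPiece L) {z : Plane}
    (hz : z ≠ 0) (h : L z = 0) (y : Plane) : ∃ m : ℝ, L y = m • rot z := by
  have hz' := sq_add_sq_pos hz
  rcases hL with ⟨a, b, hab, hL⟩ | ⟨e, he, hL⟩
  · refine ⟨0, ?_⟩
    rw [hL] at h ⊢
    have h0 := congrArg (fun v : Plane => v 0) h
    have h1 := congrArg (fun v : Plane => v 1) h
    simp only [PiLp.add_apply, PiLp.smul_apply, smul_eq_mul, rot_zero_coord,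
      rot_one_coord, PiLp.zero_apply] at h0 h1
    have hb : b = 0 := by
      have : b * (z 0 ^ 2 + z 1 ^ 2) = 0 := by linear_combination z 0 * h1 - z 1 * h0
      exact (mul_eq_zero.1 this).resolve_right hz'.ne'
    have ha : a = 0 := by
      have : a * (z 0 ^ 2 + z 1 ^ 2) = 0 := by linear_combination z 0 * h0 + z 1 * h1
      exact (mul_eq_zero.1 this).resolve_right hz'.ne'
    simp [hb, ha]
  · have he0 : e ≠ 0 := by rintro rfl; simp at he
    rw [hL] at h ⊢
    have h := (smul_eq_zero.1 h).resolve_right he0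
    rw [inner_eq] at h
    refine ⟨inner ℝ e y * ((z 0 * e 1 - z 1 * e 0) / (z 0 ^ 2 + z 1 ^ 2)), ?_⟩
    rw [mul_smul]
    congr 1
    apply ext_coord <;> simp only [PiLp.smul_apply, smul_eq_mul, rot_zero_coord, rot_one_coord] <;>
      field_simp
    · linear_combination z 0 * h
    · linear_combination z 1 * h

lemma IsProjPiece.douglasRachford {P Q : Plane →ₗ[ℝ] Plane} (hP : IsProjPiece P)
    (hQ : IsProjPiece Q) :
    IsPiece (LinearMap.id - P + Q ∘ₗ ((2 : ℝ) • P - LinearMap.id)) := by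
  have key : ∀ e : Plane, e 0 ^ 2 + e 1 ^ 2 = 1 → ∀ y : Plane,
      y - (inner ℝ e y : ℝ) • e = (inner ℝ (rot e) y : ℝ) • rot e := by
    intro e he y
    simp only [inner_eq]
    apply ext_coord <;> simp
    · linear_combination (-y 0) * he
    · linear_combination (-y 1) * he
  rcases hP with rfl | rfl | ⟨e, he, rfl⟩ <;> rcases hQ with rfl | rfl | ⟨f, hf, rfl⟩
  · exact Or.inl ⟨1, 0, by norm_num, fun y => by simp⟩
  · exact Or.inl ⟨0, 0, by norm_num, fun y => by simp⟩
  · refine Or.inr ⟨rot f, by simp; linarith, fun y => ?_⟩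
    rw [← key f hf]
    simp [sub_eq_add_neg]
  · exact Or.inl ⟨0, 0, by norm_num, fun y => by simp⟩
  · exact Or.inl ⟨1, 0, by norm_num, fun y => by simp [two_smul]⟩
  · exact Or.inr ⟨f, hf, fun y => by simp [two_smul]⟩
  · exact Or.inr ⟨rot e, by simp; linarith, fun y => by rw [← key e he]; simp⟩
  · exact Or.inr ⟨e, he, fun y => by simp [two_smul]⟩
  · refine Or.inl ⟨(e 0 * f 0 + e 1 * f 1) ^ 2,
      (e 0 * f 0 + e 1 * f 1) * (e 0 * f 1 - e 1 * f 0), ?_, fun y => ?_⟩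
    · have : (e 0 * f 0 + e 1 * f 1) ^ 2 + (e 0 * f 1 - e 1 * f 0) ^ 2 = 1 := by
        linear_combination (f 0 ^ 2 + f 1 ^ 2) * he + hf
      linear_combination (e 0 * f 0 + e 1 * f 1) ^ 2 * this
    · apply ext_coord <;>
        simp only [inner_eq, LinearMap.add_apply, LinearMap.sub_apply, LinearMap.id_apply,
          lineProj_apply, LinearMap.comp_apply, LinearMap.smul_apply, PiLp.add_apply,
          PiLp.sub_apply, PiLp.smul_apply, smul_eq_mul, rot_zero_coord, rot_one_coord]
      · linear_combination (-y 0 * (1 - f 0 ^ 2) + y 1 * (f 0 * f 1)) * he +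
          (-y 0 * e 1 ^ 2 + y 1 * (e 0 * e 1)) * hf
      · linear_combination (-y 1 * (1 - f 1 ^ 2) + y 0 * (f 0 * f 1)) * he +
          (-y 1 * e 0 ^ 2 + y 0 * (e 0 * e 1)) * hf

section Projection

variable {C : Set Plane} {P : Plane → Plane}

lemma proj_inner_le (hconv : Convex ℝ C)
    (hP : ∀ x, P x ∈ C ∧ ∀ w ∈ C, ‖x - P x‖ ≤ ‖x - w‖) (x : Plane) {w : Plane} (hw : w ∈ C) :
    (inner ℝ (x - P x) (w - P x) : ℝ) ≤ 0 := by
  refine (norm_eq_iInf_iff_real_inner_le_zero hconv (hP x).1).1 ?_ w hw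
  have : Nonempty C := ⟨⟨P x, (hP x).1⟩⟩
  refine le_antisymm (le_ciInf fun w => (hP x).2 w w.2) ?_
  exact ciInf_le ⟨0, by rintro _ ⟨w, rfl⟩; exact norm_nonneg _⟩ (⟨P x, (hP x).1⟩ : C)

lemma proj_firm (hconv : Convex ℝ C)
    (hP : ∀ x, P x ∈ C ∧ ∀ w ∈ C, ‖x - P x‖ ≤ ‖x - w‖) (x y : Plane) :
    ‖P x - P y‖ ^ 2 ≤ inner ℝ (P x - P y) (x - y) := by
  have h1 := proj_inner_le hconv hP x (hP y).1
  have h2 := proj_inner_le hconv hP y (hP x).1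
  simp only [inner_eq, norm_sq_eq, PiLp.sub_apply] at *
  linarith

lemma proj_orthogonal (hconv : Convex ℝ C) (hcone : ∀ x ∈ C, ∀ t : ℝ, 0 < t → t • x ∈ C)
    (hP : ∀ x, P x ∈ C ∧ ∀ w ∈ C, ‖x - P x‖ ≤ ‖x - w‖) (x : Plane) :
    (inner ℝ (x - P x) (P x) : ℝ) = 0 := by
  have h1 := proj_inner_le hconv hP x (hcone _ (hP x).1 2 (by norm_num))
  have h2 := proj_inner_le hconv hP x (hcone _ (hP x).1 (1 / 2) (by norm_num))
  simp only [inner_eq, PiLp.sub_apply, PiLp.smul_apply, smul_eq_mul] at *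
  linarith

lemma proj_polar (hconv : Convex ℝ C) (hcone : ∀ x ∈ C, ∀ t : ℝ, 0 < t → t • x ∈ C)
    (hP : ∀ x, P x ∈ C ∧ ∀ w ∈ C, ‖x - P x‖ ≤ ‖x - w‖) (x : Plane) {w : Plane} (hw : w ∈ C) :
    (inner ℝ (x - P x) w : ℝ) ≤ 0 := by
  have h1 := proj_inner_le hconv hP x hw
  rwa [inner_sub_right, proj_orthogonal hconv hcone hP x, sub_zero] at h1

lemma proj_smul (hconv : Convex ℝ C) (hcone : ∀ x ∈ C, ∀ t : ℝ, 0 < t → t • x ∈ C)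
    (hP : ∀ x, P x ∈ C ∧ ∀ w ∈ C, ‖x - P x‖ ≤ ‖x - w‖) {t : ℝ} (ht : 0 < t) (x : Plane) :
    P (t • x) = t • P x := by
  have h1 := proj_inner_le hconv hP (t • x) (hcone _ (hP x).1 t ht)
  have h2 := mul_nonpos_of_nonneg_of_nonpos ht.le
    (proj_polar hconv hcone hP x (hP (t • x)).1)
  have h3 := proj_orthogonal hconv hcone hP x
  rw [← sub_eq_zero, ← norm_eq_zero, ← sq_eq_zero_iff]
  refine le_antisymm ?_ (sq_nonneg _)
  simp only [inner_eq, norm_sq_eq, PiLp.sub_apply, PiLp.smul_apply, smul_eq_mul] at *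
  linear_combination h1 + h2 - t ^ 2 * h3

/-- All projections onto a planar convex cone that move points to the same side land on a
single line. -/
lemma exists_lineProj_of_side (hconv : Convex ℝ C)
    (hcone : ∀ x ∈ C, ∀ t : ℝ, 0 < t → t • x ∈ C)
    (hP : ∀ x, P x ∈ C ∧ ∀ w ∈ C, ‖x - P x‖ ≤ ‖x - w‖) (s : ℝ) :
    ∃ e : Plane, e 0 ^ 2 + e 1 ^ 2 = 1 ∧
      ∀ x, 0 < s * area (P x) (x - P x) → P x = lineProj e x := by
  by_cases h : ∃ y, 0 < s * area (P y) (y - P y)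
  · obtain ⟨y, hy⟩ := h
    have hp : P y ≠ 0 := by intro h; simp [h, area] at hy
    have hp' := sq_add_sq_pos hp
    refine ⟨‖P y‖⁻¹ • P y, ?_, fun x hx => ?_⟩
    · rw [← norm_sq_eq, norm_smul, norm_inv, norm_norm, inv_mul_cancel₀ (norm_ne_zero_iff.2 hp),
        one_pow]
    · have hq : P x ≠ 0 := by intro h; simp [h, area] at hx
      have hq' := sq_add_sq_pos hq
      have hxy := proj_polar hconv hcone hP x (hP y).1
      have hyx := proj_polar hconv hcone hP y (hP x).1
      have hxx := proj_orthogonal hconv hcone hP x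
      have hyy := proj_orthogonal hconv hcone hP y
      rw [lineProj_apply, real_inner_smul_left, smul_smul]
      have hn : ‖P y‖⁻¹ * inner ℝ (P y) x * ‖P y‖⁻¹ =
          inner ℝ (P y) x / (P y 0 ^ 2 + P y 1 ^ 2) := by
        rw [← norm_sq_eq]; field_simp
      rw [hn]
      simp only [inner_eq, area, PiLp.sub_apply] at *
      generalize P x = q at *
      generalize P y = p at *
      -- `area p q` has both signs, hence vanishes
      have e1 : (p 0 ^ 2 + p 1 ^ 2) * ((y 0 - p 0) * q 0 + (y 1 - p 1) * q 1) =
          (p 0 * (y 1 - p 1) - p 1 * (y 0 - p 0)) * (p 0 * q 1 - p 1 * q 0) := by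
        linear_combination (p 0 * q 0 + p 1 * q 1) * hyy
      have e2 : (q 0 ^ 2 + q 1 ^ 2) * ((x 0 - q 0) * p 0 + (x 1 - q 1) * p 1) =
          (q 0 * (x 1 - q 1) - q 1 * (x 0 - q 0)) * (-(p 0 * q 1 - p 1 * q 0)) := by
        linear_combination (p 0 * q 0 + p 1 * q 1) * hxx
      have i1 := mul_nonpos_of_nonneg_of_nonpos hp'.le hyx
      have i2 := mul_nonpos_of_nonneg_of_nonpos hq'.le hxy
      rw [e1] at i1
      rw [e2] at i2
      have a0 : p 0 * q 1 - p 1 * q 0 = 0 := by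
        generalize p 0 * q 1 - p 1 * q 0 = a at *
        generalize p 0 * (y 1 - p 1) - p 1 * (y 0 - p 0) = m at *
        generalize q 0 * (x 1 - q 1) - q 1 * (x 0 - q 0) = k at *
        have hs : s ≠ 0 := by rintro rfl; simp at hx
        rcases lt_or_gt_of_ne hs with hs | hs
        · have hm : m < 0 := by nlinarith
          have hk : k < 0 := by nlinarith
          nlinarith
        · have hm : 0 < m := by nlinarith
          have hk : 0 < k := by nlinarith
          nlinarith
      have hpx : (p 0 * x 0 + p 1 * x 1) = p 0 * q 0 + p 1 * q 1 := by
        have : (q 0 ^ 2 + q 1 ^ 2) * (p 0 * (x 0 - q 0) + p 1 * (x 1 - q 1)) = 0 := by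
          linear_combination e2 - (q 0 * (x 1 - q 1) - q 1 * (x 0 - q 0)) * a0
        have := (mul_eq_zero.1 this).resolve_left hq'.ne'
        linarith
      rw [hpx]
      apply ext_coord <;> simp only [PiLp.smul_apply, smul_eq_mul] <;> field_simp
      · linear_combination (-p 1) * a0
      · linear_combination p 0 * a0
  · exact ⟨!₂[1, 0], by simp, fun x hx => absurd ⟨x, hx⟩ h⟩

lemma exists_projPieces (hconv : Convex ℝ C)
    (hcone : ∀ x ∈ C, ∀ t : ℝ, 0 < t → t • x ∈ C)
    (hP : ∀ x, P x ∈ C ∧ ∀ w ∈ C, ‖x - P x‖ ≤ ‖x - w‖) :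
    ∃ S : Set (Plane →ₗ[ℝ] Plane), S.Finite ∧ (∀ L ∈ S, IsProjPiece L) ∧
      ∀ x, ∃ L ∈ S, P x = L x := by
  obtain ⟨e, he, hPe⟩ := exists_lineProj_of_side hconv hcone hP 1
  obtain ⟨f, hf, hPf⟩ := exists_lineProj_of_side hconv hcone hP (-1)
  refine ⟨{0, LinearMap.id, lineProj e, lineProj f}, by simp, ?_, fun x => ?_⟩
  · rintro L (rfl | rfl | rfl | rfl)
    exacts [Or.inl rfl, Or.inr (Or.inl rfl), Or.inr (Or.inr ⟨e, he, rfl⟩),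
      Or.inr (Or.inr ⟨f, hf, rfl⟩)]
  · rcases lt_trichotomy 0 (area (P x) (x - P x)) with h | h | h
    · exact ⟨lineProj e, by simp, hPe x (by linarith)⟩
    · by_cases h0 : P x = 0
      · exact ⟨0, by simp, h0⟩
      · refine ⟨LinearMap.id, by simp, ?_⟩
        have h0 := sq_add_sq_pos h0
        have horth := proj_orthogonal hconv hcone hP x
        simp only [inner_eq, area, PiLp.sub_apply] at *
        have k0 : (P x 0 ^ 2 + P x 1 ^ 2) * (x 0 - P x 0) = 0 := by
          linear_combination P x 0 * horth + P x 1 * h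
        have k1 : (P x 0 ^ 2 + P x 1 ^ 2) * (x 1 - P x 1) = 0 := by
          linear_combination P x 1 * horth - P x 0 * h
        have k0 := (mul_eq_zero.1 k0).resolve_left h0.ne'
        have k1 := (mul_eq_zero.1 k1).resolve_left h0.ne'
        exact ext_coord (by simp; linarith) (by simp; linarith)
    · exact ⟨lineProj f, by simp, hPf x (by linarith)⟩

end Projection

section Dynamics

variable {T : Plane → Plane} {S : Set (Plane →ₗ[ℝ] Plane)}

lemma continuous_of_firm (hfirm : ∀ x y, ‖T x - T y‖ ^ 2 ≤ inner ℝ (T x - T y) (x - y)) :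
    Continuous T := by
  have : LipschitzWith 1 T := by
    refine LipschitzWith.of_dist_le_mul fun x y => ?_
    rw [dist_eq_norm, dist_eq_norm, NNReal.coe_one, one_mul]
    have h1 := hfirm x y
    have h2 := real_inner_le_norm (T x - T y) (x - y)
    by_contra! h
    nlinarith [norm_nonneg (x - y), norm_nonneg (T x - T y)]
  exact this.continuous

lemma eventually_piece (hT : Continuous T) (hfin : S.Finite) (hpw : ∀ x, ∃ L ∈ S, T x = L x)
    (z : Plane) : ∀ᶠ y in 𝓝 z, ∃ L ∈ S, L z = T z ∧ T y = L y := by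
  have : ∀ᶠ y in 𝓝 z, ∀ L ∈ S, L z ≠ T z → L y ≠ T y := by
    refine (eventually_all_finite hfin).2 fun L _ => ?_
    by_cases h : L z = T z
    · exact Eventually.of_forall fun y hy => absurd h hy
    · have hL : Continuous L := L.continuous_of_finiteDimensional
      filter_upwards [(isOpen_ne_fun hL hT).mem_nhds h] with y hy _ using hy
  filter_upwards [this] with y hy
  obtain ⟨L, hL, hLy⟩ := hpw y
  exact ⟨L, hL, not_not.1 fun h => hy L hL h hLy.symm, hLy⟩

lemma eventually_fixed (hT : Continuous T) (hfin : S.Finite) (hS : ∀ L ∈ S, IsPiece L)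
    (hpw : ∀ x, ∃ L ∈ S, T x = L x) (hhom : ∀ t : ℝ, 0 < t → ∀ x, T (t • x) = t • T x)
    {z : Plane} (hz : z ≠ 0) (hTz : T z = z) : ∀ᶠ y in 𝓝 z, T (T y) = T y := by
  have hpos : ∀ᶠ y in 𝓝 z, 0 < (inner ℝ z y : ℝ) := by
    have : Continuous fun y : Plane => (inner ℝ z y : ℝ) := by fun_prop
    exact this.continuousAt.eventually (lt_mem_nhds (real_inner_self_pos.2 hz))
  filter_upwards [hpos, eventually_piece hT hfin hpw z] with y hy ⟨L, hL, hLz, hLy⟩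
  rcases (hS L hL).of_fixed hz (hLz.trans hTz) y with h | h
  · rw [hLy, h, hLy, h]
  · rw [hLy, h, hhom _ (div_pos hy (sq_add_sq_pos hz)), hTz]

lemma eventually_of_zero (hT : Continuous T) (hfin : S.Finite) (hS : ∀ L ∈ S, IsPiece L)
    (hpw : ∀ x, ∃ L ∈ S, T x = L x) {z : Plane} (hz : z ≠ 0) (hTz : T z = 0) :
    ∀ᶠ y in 𝓝 z, ∃ m : ℝ, T y = m • rot z := by
  filter_upwards [eventually_piece hT hfin hpw z] with y ⟨L, hL, hLz, hLy⟩
  rw [hLy]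
  exact (hS L hL).of_zero hz (hLz.trans hTz) y

/-- An orbit of a firmly nonexpansive map cannot pass over a ray of fixed points. -/
lemma area_mul_area_pos (hfirm : ∀ x y, ‖T x - T y‖ ^ 2 ≤ inner ℝ (T x - T y) (x - y))
    (hhom : ∀ t : ℝ, 0 < t → ∀ x, T (t • x) = t • T x) {z x : Plane} (hz : z ≠ 0)
    (hTz : T z = z) (hpos : 0 < (inner ℝ z (T x) : ℝ)) (ha : area z (T x) ≠ 0) :
    0 < area z x * area z (T x) := by
  have hz' := sq_add_sq_pos hz
  set k : ℝ := inner ℝ z (T x) / (z 0 ^ 2 + z 1 ^ 2) with hk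
  have hk' : k * (z 0 ^ 2 + z 1 ^ 2) = inner ℝ z (T x) := div_mul_cancel₀ _ hz'.ne'
  have h := hfirm x (k • z)
  rw [hhom k (div_pos hpos hz') z, hTz] at h
  have ha' : 0 < area z (T x) ^ 2 := by positivity
  refine ha'.trans_le ?_
  have h := mul_le_mul_of_nonneg_left h hz'.le
  simp only [norm_sq_eq, inner_eq, area, PiLp.sub_apply, PiLp.smul_apply, smul_eq_mul] at *
  generalize T x = p at *
  clear_value k
  have i1 : (z 0 ^ 2 + z 1 ^ 2) * ((p 0 - k * z 0) ^ 2 + (p 1 - k * z 1) ^ 2) =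
      (z 0 * p 1 - z 1 * p 0) ^ 2 := by
    linear_combination (k * (z 0 ^ 2 + z 1 ^ 2) - (z 0 * p 0 + z 1 * p 1)) * hk'
  have i2 : (z 0 ^ 2 + z 1 ^ 2) *
      ((p 0 - k * z 0) * (x 0 - k * z 0) + (p 1 - k * z 1) * (x 1 - k * z 1)) =
      (z 0 * x 1 - z 1 * x 0) * (z 0 * p 1 - z 1 * p 0) := by
    linear_combination (k * (z 0 ^ 2 + z 1 ^ 2) - (z 0 * x 0 + z 1 * x 1)) * hk'
  linarith

/-- The circle through `x`, run through in the direction given by the sign `s`. -/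
noncomputable def circ (x : Plane) (s t : ℝ) : Plane :=
  Real.cos t • x + (s * Real.sin t) • rot x

lemma circ_zero_coord (x : Plane) (s t : ℝ) :
    circ x s t 0 = Real.cos t * x 0 - s * Real.sin t * x 1 := by
  simp [circ]; ring

lemma circ_one_coord (x : Plane) (s t : ℝ) :
    circ x s t 1 = Real.cos t * x 1 + s * Real.sin t * x 0 := by
  simp [circ]

lemma circ_zero (x : Plane) (s : ℝ) : circ x s 0 = x := by simp [circ]

lemma continuous_circ (x : Plane) (s : ℝ) : Continuous (circ x s) := by
  unfold circ; fun_prop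

lemma inner_circ (x : Plane) {s : ℝ} (hs : s ^ 2 = 1) (t u : ℝ) :
    (inner ℝ (circ x s t) (circ x s u) : ℝ) = Real.cos (u - t) * (x 0 ^ 2 + x 1 ^ 2) := by
  rw [inner_eq, Real.cos_sub]
  simp only [circ_zero_coord, circ_one_coord]
  linear_combination (Real.sin t * Real.sin u * (x 0 ^ 2 + x 1 ^ 2)) * hs

lemma area_circ (x : Plane) (s t u : ℝ) :
    area (circ x s t) (circ x s u) = s * Real.sin (u - t) * (x 0 ^ 2 + x 1 ^ 2) := by
  rw [area, Real.sin_sub]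
  simp only [circ_zero_coord, circ_one_coord]
  ring

lemma circ_ne_zero {x : Plane} (hx : x ≠ 0) {s : ℝ} (hs : s ^ 2 = 1) (t : ℝ) :
    circ x s t ≠ 0 := by
  intro h
  have := inner_circ x hs t t
  rw [h] at this
  simp at this
  exact (sq_add_sq_pos hx).ne this

lemma circ_norm_sq (x : Plane) {s : ℝ} (hs : s ^ 2 = 1) (t : ℝ) :
    circ x s t 0 ^ 2 + circ x s t 1 ^ 2 = x 0 ^ 2 + x 1 ^ 2 := by
  have := inner_circ x hs t t
  rw [inner_eq] at this
  simp at this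
  linarith

/-- Polar coordinates in the orthogonal frame at the point `circ x s t`, in a half plane. -/
lemma exists_circ_eq {x : Plane} {s : ℝ} (hs : s ^ 2 = 1) (t : ℝ) {p : Plane}
    (hx : x ≠ 0) (hp : 0 < (inner ℝ (circ x s t) p : ℝ)) :
    ∃ r : ℝ, 0 < r ∧ p = r • circ x s (t + Real.arctan
      (s * area (circ x s t) p / inner ℝ (circ x s t) p)) := by
  set y := circ x s t with hy
  have hy0 := sq_add_sq_pos (circ_ne_zero hx hs t)
  rw [← hy] at hy0
  set τ := Real.arctan (s * area y p / inner ℝ y p) with hτ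
  have hc : 0 < Real.cos τ := Real.cos_arctan_pos _
  have htan : Real.sin τ * inner ℝ y p = s * area y p * Real.cos τ := by
    have : Real.tan τ = s * area y p / inner ℝ y p := Real.tan_arctan _
    rw [Real.tan_eq_sin_div_cos, div_eq_div_iff hc.ne' hp.ne'] at this
    linarith
  have h0 : circ x s (t + τ) 0 = Real.cos τ * y 0 - s * Real.sin τ * y 1 := by
    simp only [hy, circ_zero_coord, circ_one_coord, Real.cos_add, Real.sin_add]
    linear_combination (Real.sin t * Real.sin τ * x 0) * hs
  have h1 : circ x s (t + τ) 1 = Real.cos τ * y 1 + s * Real.sin τ * y 0 := by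
    simp only [hy, circ_zero_coord, circ_one_coord, Real.cos_add, Real.sin_add]
    linear_combination (Real.sin t * Real.sin τ * x 1) * hs
  refine ⟨inner ℝ y p / (Real.cos τ * (y 0 ^ 2 + y 1 ^ 2)), by positivity, ?_⟩
  clear_value τ y
  simp only [inner_eq, area] at htan ⊢
  apply ext_coord <;> simp only [PiLp.smul_apply, smul_eq_mul, h0, h1] <;> field_simp
  · linear_combination (s * y 1) * htan + Real.cos τ * y 1 * (y 0 * p 1 - y 1 * p 0) * hs
  · linear_combination (-s * y 0) * htan - Real.cos τ * y 0 * (y 0 * p 1 - y 1 * p 0) * hs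

lemma exists_circ_eq_of_ne_zero {x : Plane} (hx : x ≠ 0) {s : ℝ} (hs : s ^ 2 = 1) {p : Plane}
    (hp : p ≠ 0) : ∃ t r : ℝ, 0 ≤ t ∧ 0 < r ∧ p = r • circ x s t := by
  have hx0 := sq_add_sq_pos hx
  set w : ℂ := ⟨inner ℝ x p, s * area x p⟩ with hw
  have hw0 : w ≠ 0 := by
    intro h
    have h0 : (inner ℝ x p : ℝ) = 0 := congrArg Complex.re h
    have h1 : s * area x p = 0 := congrArg Complex.im h
    have : (x 0 ^ 2 + x 1 ^ 2) * (p 0 ^ 2 + p 1 ^ 2) = 0 := by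
      simp only [inner_eq, area] at h0 h1
      linear_combination (x 0 * p 0 + x 1 * p 1) * h0 + s * (x 0 * p 1 - x 1 * p 0) * h1
        - (x 0 * p 1 - x 1 * p 0) ^ 2 * hs
    exact (mul_pos hx0 (sq_add_sq_pos hp)).ne' this
  have hre : ‖w‖ * Real.cos w.arg = inner ℝ x p := Complex.norm_mul_cos_arg w
  have him : ‖w‖ * Real.sin w.arg = s * area x p := Complex.norm_mul_sin_arg w
  have hn : 0 < ‖w‖ := norm_pos_iff.2 hw0
  refine ⟨w.arg + 2 * Real.pi, ‖w‖ / (x 0 ^ 2 + x 1 ^ 2), ?_, by positivity, ?_⟩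
  · linarith [Complex.neg_pi_lt_arg w, Real.pi_pos]
  · simp only [inner_eq, area] at hre him
    apply ext_coord <;> simp only [PiLp.smul_apply, smul_eq_mul, circ_zero_coord,
      circ_one_coord, Real.cos_add_two_pi, Real.sin_add_two_pi] <;> field_simp
    · linear_combination (-x 0) * hre + s * x 1 * him + x 1 * (x 0 * p 1 - x 1 * p 0) * hs
    · linear_combination (-x 1) * hre - s * x 0 * him - x 0 * (x 0 * p 1 - x 1 * p 0) * hs

lemma fixed_of_le {n m : ℕ} (hnm : n ≤ m) {x : Plane} (h : T (T^[n] x) = T^[n] x) :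
    T (T^[m] x) = T^[m] x := by
  obtain ⟨k, rfl⟩ := Nat.exists_eq_add_of_le' hnm
  have hk : T^[k + n] x = T^[n] x := by
    rw [Function.iterate_add_apply]
    exact Function.iterate_fixed h k
  rw [hk, h]

lemma map_zero_of_hom (hhom : ∀ t : ℝ, 0 < t → ∀ x, T (t • x) = t • T x) : T 0 = 0 := by
  have := hhom 2 (by norm_num) 0
  rw [smul_zero, two_smul] at this
  exact left_eq_add.1 this

lemma iterate_smul_of_hom (hhom : ∀ t : ℝ, 0 < t → ∀ x, T (t • x) = t • T x) {t : ℝ}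
    (ht : 0 < t) (n : ℕ) (x : Plane) : T^[n] (t • x) = t • T^[n] x := by
  induction n generalizing x with
  | zero => rfl
  | succ n ih => rw [Function.iterate_succ_apply, Function.iterate_succ_apply, hhom t ht, ih]

lemma fixed_smul_iff (hhom : ∀ t : ℝ, 0 < t → ∀ x, T (t • x) = t • T x) {t : ℝ}
    (ht : 0 < t) (n : ℕ) (x : Plane) :
    T (T^[n] (t • x)) = T^[n] (t • x) ↔ T (T^[n] x) = T^[n] x := by
  rw [iterate_smul_of_hom hhom ht, hhom t ht]
  exact (smul_right_injective Plane ht.ne').eq_iff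

/-- In the direction of motion, the arc starting at a moving point ends at a fixed point. -/
lemma exists_first_fixed (hfin : S.Finite) (hS : ∀ L ∈ S, IsPiece L)
    (hpw : ∀ x, ∃ L ∈ S, T x = L x) (hhom : ∀ t : ℝ, 0 < t → ∀ x, T (t • x) = t • T x)
    (hfirm : ∀ x y, ‖T x - T y‖ ^ 2 ≤ inner ℝ (T x - T y) (x - y))
    {c : Plane} (hc : c ≠ 0) (hTc : T c = c) {x : Plane} (hx : x ≠ 0) {s : ℝ} (hs : s ^ 2 = 1)
    (hpos : 0 < s * area x (T x)) :
    ∃ b : ℝ, 0 < b ∧ T (circ x s b) = circ x s b ∧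
      ∀ t, 0 ≤ t → t < b → 0 < s * area (circ x s t) (T (circ x s t)) := by
  have hT := continuous_of_firm hfirm
  have hx0 := sq_add_sq_pos hx
  set h : ℝ → ℝ := fun t => s * area (circ x s t) (T (circ x s t)) with hh
  have hcirc := continuous_circ x s
  have hcont : Continuous h := by
    have := hT.comp hcirc
    simp only [Function.comp_def] at this
    simp only [hh, area]
    fun_prop
  set Z : Set ℝ := Ici 0 ∩ h ⁻¹' Iic 0 with hZ
  have hZc : IsClosed Z := isClosed_Ici.inter (isClosed_Iic.preimage hcont)
  have hZb : BddBelow Z := ⟨0, fun t ht => ht.1⟩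
  have hZn : Z.Nonempty := by
    obtain ⟨t, r, ht, hr, hcr⟩ := exists_circ_eq_of_ne_zero hx hs hc
    refine ⟨t, ht, ?_⟩
    have : T (circ x s t) = circ x s t := by
      rw [hcr, hhom r hr] at hTc
      exact smul_right_injective Plane hr.ne' hTc
    simp [hh, this, area, mul_comm]
  have hbZ : sInf Z ∈ Z := hZc.csInf_mem hZn hZb
  set b := sInf Z with hb
  have hlt : ∀ t, 0 ≤ t → t < b → 0 < h t := fun t ht htb => by
    by_contra! hneg
    exact absurd (csInf_le hZb (show t ∈ Z from ⟨ht, hneg⟩)) (not_le.2 htb)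
  have hb0 : 0 < b := by
    refine lt_of_le_of_ne hbZ.1 fun h0 => ?_
    have := hbZ.2
    rw [← h0] at this
    simp only [hh, mem_preimage, circ_zero, mem_Iic] at this
    linarith
  have hleft : ∀ᶠ t in 𝓝[<] b, t ∈ Ioo 0 b := Ioo_mem_nhdsLT hb0
  have hhb : h b = 0 := by
    refine le_antisymm hbZ.2 ?_
    refine ge_of_tendsto (hcont.continuousAt.mono_left nhdsWithin_le_nhds : Tendsto h (𝓝[<] b) _) ?_
    filter_upwards [hleft] with t ht using (hlt t ht.1.le ht.2).le
  refine ⟨b, hb0, ?_, hlt⟩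
  have hz := circ_ne_zero hx hs b
  have harea : area (circ x s b) (T (circ x s b)) = 0 := by
    refine (mul_eq_zero.1 hhb).resolve_left ?_
    rintro rfl
    norm_num at hs
  obtain ⟨L, hL, hLz⟩ := hpw (circ x s b)
  rw [hLz] at harea ⊢
  refine ((hS L hL).zero_or_fixed hz harea).resolve_left fun hzero => ?_
  have hnear : ∀ᶠ t in 𝓝[<] b, ∃ m : ℝ, T (circ x s t) = m • rot (circ x s b) :=
    (hcirc.continuousAt.mono_left nhdsWithin_le_nhds : Tendsto _ (𝓝[<] b) _).eventually
      (eventually_of_zero hT hfin hS hpw hz (hLz.trans hzero))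
  have hclose : ∀ᶠ t in 𝓝[<] b, t ∈ Ioo (b - Real.pi / 2) b :=
    Ioo_mem_nhdsLT (by linarith [Real.pi_pos])
  obtain ⟨t, ⟨m, hm⟩, ht0, htc⟩ := (hnear.and (hleft.and hclose)).exists
  have hpt := hlt t ht0.1.le ht0.2
  have hf := hfirm (circ x s t) 0
  rw [map_zero_of_hom hhom, sub_zero, sub_zero, hm] at hf
  simp only [hh, hm] at hpt
  have hcos : 0 < Real.cos (b - t) :=
    Real.cos_pos_of_mem_Ioo ⟨by linarith [htc.2, Real.pi_pos], by linarith [htc.1]⟩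
  have hsin : 0 < Real.sin (b - t) :=
    Real.sin_pos_of_pos_of_lt_pi (by linarith [htc.2]) (by linarith [htc.1, Real.pi_pos])
  have h1 : area (circ x s t) (m • rot (circ x s b)) =
      m * inner ℝ (circ x s t) (circ x s b) := by
    simp [inner_eq, area]; ring
  have h2 : (inner ℝ (m • rot (circ x s b)) (circ x s t) : ℝ) =
      -(m * area (circ x s t) (circ x s b)) := by
    simp [inner_eq, area]; ring
  rw [h1, inner_circ x hs] at hpt
  rw [h2, area_circ] at hf
  have hsm : 0 < s * m := by
    have : 0 < (s * m) * (Real.cos (b - t) * (x 0 ^ 2 + x 1 ^ 2)) := by linarith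
    exact (pos_iff_pos_of_mul_pos this).2 (by positivity)
  have : 0 < (s * m) * (Real.sin (b - t) * (x 0 ^ 2 + x 1 ^ 2)) := by positivity
  nlinarith [sq_nonneg ‖m • rot (circ x s b)‖]

lemma exists_step (hhom : ∀ t : ℝ, 0 < t → ∀ x, T (t • x) = t • T x)
    (hfirm : ∀ x y, ‖T x - T y‖ ^ 2 ≤ inner ℝ (T x - T y) (x - y))
    {x : Plane} (hx : x ≠ 0) {s : ℝ} (hs : s ^ 2 = 1) {b t d : ℝ}
    (hb : T (circ x s b) = circ x s b) (htb : t < b) (hd : 0 < d)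
    (hdt : d ≤ s * area (circ x s t) (T (circ x s t))) :
    ∃ r u : ℝ, 0 < r ∧ t + Real.arctan (d / (x 0 ^ 2 + x 1 ^ 2)) ≤ u ∧ u ≤ b ∧
      T (circ x s t) = r • circ x s u := by
  have hx0 := sq_add_sq_pos hx
  have hs0 : s ≠ 0 := by rintro rfl; norm_num at hs
  have hf := hfirm (circ x s t) 0
  rw [map_zero_of_hom hhom, sub_zero, sub_zero, real_inner_comm] at hf
  have hTne : T (circ x s t) ≠ 0 := by
    intro h
    rw [h] at hdt
    simp [area] at hdt
    linarith
  have hin : 0 < (inner ℝ (circ x s t) (T (circ x s t)) : ℝ) :=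
    lt_of_lt_of_le (by positivity) hf
  have hin' : (inner ℝ (circ x s t) (T (circ x s t)) : ℝ) ≤ x 0 ^ 2 + x 1 ^ 2 := by
    have h1 := sq_nonneg ‖circ x s t - T (circ x s t)‖
    rw [norm_sub_sq_real, norm_sq_eq (circ x s t), circ_norm_sq x hs] at h1
    linarith
  obtain ⟨r, hr, hrp⟩ := exists_circ_eq hs t hx hin
  set q := s * area (circ x s t) (T (circ x s t)) with hq
  set p : ℝ := inner ℝ (circ x s t) (T (circ x s t)) with hp
  refine ⟨r, _, hr, ?_, ?_, hrp⟩
  · refine add_le_add le_rfl ?_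
    exact Real.arctan_strictMono.monotone (div_le_div₀ (hd.le.trans hdt) hdt hin hin')
  · set τ := Real.arctan (q / p) with hτ
    by_contra! hlt
    have hτ2 : τ < Real.pi / 2 := Real.arctan_lt_pi_div_two _
    have hcos : 0 < Real.cos (t + τ - b) :=
      Real.cos_pos_of_mem_Ioo ⟨by linarith [Real.pi_pos], by linarith⟩
    have hsin : 0 < Real.sin (t + τ - b) :=
      Real.sin_pos_of_pos_of_lt_pi (by linarith) (by linarith [Real.pi_pos])
    have hsin' : Real.sin (t - b) < 0 :=
      Real.sin_neg_of_neg_of_neg_pi_lt (by linarith) (by linarith [Real.pi_pos])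
    have hA : area (circ x s b) (T (circ x s t)) =
        s * (r * (Real.sin (t + τ - b) * (x 0 ^ 2 + x 1 ^ 2))) := by
      have := area_circ x s b (t + τ)
      rw [hrp]
      simp only [area, PiLp.smul_apply, smul_eq_mul] at this ⊢
      linear_combination r * this
    have h := area_mul_area_pos hfirm hhom (circ_ne_zero hx hs b) hb (x := circ x s t)
      (by rw [hrp, inner_smul_right, inner_circ x hs]; positivity)
      (by rw [hA]; positivity)
    rw [hA, area_circ] at h
    have h' : 0 < Real.sin (t - b) * ((x 0 ^ 2 + x 1 ^ 2) *
        (r * (Real.sin (t + τ - b) * (x 0 ^ 2 + x 1 ^ 2)))) := by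
      linear_combination h + (Real.sin (t - b) * ((x 0 ^ 2 + x 1 ^ 2) *
        (r * (Real.sin (t + τ - b) * (x 0 ^ 2 + x 1 ^ 2))))) * hs
    have h'' : 0 < (x 0 ^ 2 + x 1 ^ 2) *
        (r * (Real.sin (t + τ - b) * (x 0 ^ 2 + x 1 ^ 2))) := by positivity
    nlinarith

lemma exists_iterate_fixed (hfin : S.Finite) (hS : ∀ L ∈ S, IsPiece L)
    (hpw : ∀ x, ∃ L ∈ S, T x = L x) (hhom : ∀ t : ℝ, 0 < t → ∀ x, T (t • x) = t • T x)
    (hfirm : ∀ x y, ‖T x - T y‖ ^ 2 ≤ inner ℝ (T x - T y) (x - y))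
    {c : Plane} (hc : c ≠ 0) (hTc : T c = c) (x : Plane) :
    ∃ n : ℕ, T (T^[n] x) = T^[n] x := by
  by_contra! hnot
  have hT := continuous_of_firm hfirm
  have hT0 := map_zero_of_hom hhom
  have hx : x ≠ 0 := by rintro rfl; exact hnot 0 hT0
  have hx0 := sq_add_sq_pos hx
  have harea : area x (T x) ≠ 0 := by
    intro h
    obtain ⟨L, hL, hLx⟩ := hpw x
    rw [hLx] at h
    rcases (hS L hL).zero_or_fixed hx h with h | h
    · exact hnot 1 (by simp [hLx, h, hT0])
    · exact hnot 0 (hLx.trans h)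
  obtain ⟨s, hs, hpos⟩ : ∃ s : ℝ, s ^ 2 = 1 ∧ 0 < s * area x (T x) := by
    rcases lt_or_gt_of_ne harea with h | h
    · exact ⟨-1, by norm_num, by linarith⟩
    · exact ⟨1, by norm_num, by linarith⟩
  obtain ⟨b, hb0, hb, hmove⟩ := exists_first_fixed hfin hS hpw hhom hfirm hc hTc hx hs hpos
  have hcirc := continuous_circ x s
  obtain ⟨a, ⟨ha0, hab⟩, ha⟩ := exists_Ioc_subset_of_mem_nhds'
    (hcirc.continuousAt.eventually
      (eventually_fixed hT hfin hS hpw hhom (circ_ne_zero hx hs b) hb)) hb0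
  have hcont : Continuous fun t => s * area (circ x s t) (T (circ x s t)) := by
    have := hT.comp hcirc
    simp only [Function.comp_def] at this
    simp only [area]
    fun_prop
  obtain ⟨m, hm, hmin⟩ := isCompact_Icc.exists_isMinOn (nonempty_Icc.2 ha0) hcont.continuousOn
  set d := s * area (circ x s m) (T (circ x s m)) with hd
  have hd0 : 0 < d := hmove m hm.1 (hm.2.trans_lt hab)
  set η := Real.arctan (d / (x 0 ^ 2 + x 1 ^ 2)) with hη
  have hη0 : 0 < η := Real.arctan_pos.2 (by positivity)
  have key : ∀ k : ℕ, ∃ r t : ℝ, 0 < r ∧ k * η ≤ t ∧ t ≤ a ∧ T^[k] x = r • circ x s t := by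
    intro k
    induction k with
    | zero => exact ⟨1, 0, one_pos, by simp, ha0, by simp [circ_zero]⟩
    | succ k ih =>
      obtain ⟨r, t, hr, hkt, hta, hk⟩ := ih
      have ht0 : 0 ≤ t := le_trans (by positivity) hkt
      obtain ⟨r', u, hr', htu, hub, hu⟩ := exists_step hhom hfirm hx hs hb
        (hta.trans_lt hab) hd0 (isMinOn_iff.1 hmin t ⟨ht0, hta⟩)
      have hk' : T^[k + 1] x = (r * r') • circ x s u := by
        rw [Function.iterate_succ_apply', hk, hhom r hr, hu, smul_smul]
      refine ⟨r * r', u, mul_pos hr hr', by push_cast; linarith, ?_, hk'⟩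
      by_contra! hau
      have hfix : T (T (circ x s u)) = T (circ x s u) := ha ⟨hau, hub⟩
      refine hnot (k + 2) ?_
      rw [Function.iterate_succ_apply', hk', hhom _ (mul_pos hr hr'),
        hhom _ (mul_pos hr hr'), hfix]
  obtain ⟨k, hk⟩ := exists_nat_gt (a / η)
  obtain ⟨r, t, -, hkt, hta, -⟩ := key k
  rw [div_lt_iff₀ hη0] at hk
  linarith

/-- A positively homogeneous, firmly nonexpansive planar map with finitely many
Douglas–Rachford pieces and a nonzero fixed point reaches its fixed point set after a bounded
number of iterations. -/
lemma exists_uniform_iterate_fixed (hfin : S.Finite) (hS : ∀ L ∈ S, IsPiece L)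
    (hpw : ∀ x, ∃ L ∈ S, T x = L x) (hhom : ∀ t : ℝ, 0 < t → ∀ x, T (t • x) = t • T x)
    (hfirm : ∀ x y, ‖T x - T y‖ ^ 2 ≤ inner ℝ (T x - T y) (x - y))
    {c : Plane} (hc : c ≠ 0) (hTc : T c = c) :
    ∃ n : ℕ, ∀ x, T (T^[n] x) = T^[n] x := by
  have hT := continuous_of_firm hfirm
  have hT0 := map_zero_of_hom hhom
  have hpt := exists_iterate_fixed hfin hS hpw hhom hfirm hc hTc
  have hloc : ∀ x : Plane, x ≠ 0 → ∃ n : ℕ, ∀ᶠ y in 𝓝 x, T (T^[n] y) = T^[n] y := by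
    intro x hx
    by_cases h0 : ∃ n, T^[n] x = 0
    · classical
      obtain ⟨k, hk⟩ : ∃ k, Nat.find h0 = k + 1 := by
        refine Nat.exists_eq_succ_of_ne_zero fun h => hx ?_
        have := Nat.find_spec h0
        rwa [h] at this
      have hz : T^[k] x ≠ 0 := Nat.find_min h0 (by omega)
      have hTz : T (T^[k] x) = 0 := by
        have := Nat.find_spec h0
        rwa [hk, Function.iterate_succ_apply'] at this
      obtain ⟨n₁, h₁⟩ := hpt (rot (T^[k] x))
      obtain ⟨n₂, h₂⟩ := hpt (-rot (T^[k] x))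
      refine ⟨max n₁ n₂ + (k + 1), ?_⟩
      filter_upwards [(hT.iterate k).continuousAt.eventually
        (eventually_of_zero hT hfin hS hpw hz hTz)] with y ⟨m, hm⟩
      rw [Function.iterate_add_apply, Function.iterate_succ_apply', hm]
      rcases lt_trichotomy m 0 with h | h | h
      · rw [← neg_smul_neg m, fixed_smul_iff hhom (neg_pos.2 h)]
        exact fixed_of_le (le_max_right _ _) h₂
      · rw [h, zero_smul]
        exact fixed_of_le (Nat.zero_le _) hT0
      · rw [fixed_smul_iff hhom h]
        exact fixed_of_le (le_max_left _ _) h₁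
    · push Not at h0
      obtain ⟨n, hn⟩ := hpt x
      refine ⟨n + 1, ?_⟩
      filter_upwards [(hT.iterate n).continuousAt.eventually
        (eventually_fixed hT hfin hS hpw hhom (h0 n) hn)] with y hy
      rwa [Function.iterate_succ_apply']
  obtain ⟨n, hn⟩ : ∃ n : ℕ, ∀ y ∈ Metric.sphere (0 : Plane) 1, T (T^[n] y) = T^[n] y := by
    refine (isCompact_sphere (0 : Plane) 1).induction_on
      (p := fun U => ∃ n : ℕ, ∀ y ∈ U, T (T^[n] y) = T^[n] y) ⟨0, by simp⟩ ?_ ?_ ?_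
    · rintro U V hUV ⟨n, hn⟩
      exact ⟨n, fun y hy => hn y (hUV hy)⟩
    · rintro U V ⟨n, hn⟩ ⟨m, hm⟩
      refine ⟨max n m, ?_⟩
      rintro y (hy | hy)
      · exact fixed_of_le (le_max_left _ _) (hn y hy)
      · exact fixed_of_le (le_max_right _ _) (hm y hy)
    · intro x hx
      obtain ⟨n, hn⟩ := hloc x (ne_zero_of_mem_unit_sphere ⟨x, hx⟩)
      exact ⟨_, mem_nhdsWithin_of_mem_nhds hn, n, fun y hy => hy⟩
  refine ⟨n, fun x => ?_⟩
  by_cases hx : x = 0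
  · subst hx
    exact fixed_of_le (Nat.zero_le _) hT0
  · have hx' : 0 < ‖x‖ := norm_pos_iff.2 hx
    have := (fixed_smul_iff hhom hx' n (‖x‖⁻¹ • x)).2
      (hn _ (by simp [norm_smul, hx'.ne']))
    rwa [smul_smul, mul_inv_cancel₀ hx'.ne', one_smul] at this

end Dynamics

end Plane

/-- Let `A, B ⊆ ℝ²` be closed convex cones whose intersection contains more than one
point.  Then there exists `n ∈ ℕ` such that for every starting point `x₀ ∈ ℝ²`, the
`n`-th Douglas–Rachford iterate `T_DR^n x₀` is a fixed point of `T_DR`. -/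
theorem stmt18 (A B : Set (EuclideanSpace ℝ (Fin 2)))
    (hAclosed : IsClosed A) (hAconv : Convex ℝ A)
    (hBclosed : IsClosed B) (hBconv : Convex ℝ B)
    (hAcone : ∀ x ∈ A, ∀ t : ℝ, 0 < t → t • x ∈ A)
    (hBcone : ∀ x ∈ B, ∀ t : ℝ, 0 < t → t • x ∈ B)
    (hAB : (A ∩ B).Nontrivial)
    (PA PB T : EuclideanSpace ℝ (Fin 2) → EuclideanSpace ℝ (Fin 2))
    (hPA : ∀ x, PA x ∈ A ∧ ∀ w ∈ A, ‖x - PA x‖ ≤ ‖x - w‖)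
    (hPB : ∀ x, PB x ∈ B ∧ ∀ w ∈ B, ‖x - PB x‖ ≤ ‖x - w‖)
    (hT : ∀ x, T x = (1 / 2 : ℝ) •
      (x + ((2 : ℝ) • PB ((2 : ℝ) • PA x - x) - ((2 : ℝ) • PA x - x)))) :
    ∃ n : ℕ, ∀ x₀, T (T^[n] x₀) = T^[n] x₀ := by
  obtain ⟨SA, hSA, hSA', hpA⟩ := Plane.exists_projPieces hAconv hAcone hPA
  obtain ⟨SB, hSB, hSB', hpB⟩ := Plane.exists_projPieces hBconv hBcone hPB
  have hT' : ∀ x, T x = x - PA x + PB ((2 : ℝ) • PA x - x) := fun x => by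
    rw [hT]; module
  obtain ⟨c, ⟨hcA, hcB⟩, hc⟩ := hAB.exists_ne 0
  have hfix : ∀ (C : Set Plane) (P : Plane → Plane),
      (∀ x, P x ∈ C ∧ ∀ w ∈ C, ‖x - P x‖ ≤ ‖x - w‖) → c ∈ C → P c = c := by
    intro C P hP hcC
    have := (hP c).2 c hcC
    rw [sub_self, norm_zero] at this
    exact (sub_eq_zero.1 (norm_le_zero_iff.1 this)).symm
  have hPAc := hfix A PA hPA hcA
  have hPBc := hfix B PB hPB hcB
  refine Plane.exists_uniform_iterate_fixed
    (S := image2 (fun P Q => LinearMap.id - P + Q ∘ₗ ((2 : ℝ) • P - LinearMap.id)) SA SB)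
    (hSA.image2 _ hSB) ?_ ?_ ?_ ?_ hc ?_
  · rintro _ ⟨P, hP, Q, hQ, rfl⟩
    exact (hSA' P hP).douglasRachford (hSB' Q hQ)
  · intro x
    obtain ⟨P, hP, hPx⟩ := hpA x
    obtain ⟨Q, hQ, hQx⟩ := hpB ((2 : ℝ) • PA x - x)
    refine ⟨_, mem_image2_of_mem hP hQ, ?_⟩
    rw [hT', hQx, hPx]
    rfl
  · intro t ht x
    rw [hT', hT', Plane.proj_smul hAconv hAcone hPA ht, smul_comm,
      ← smul_sub t ((2 : ℝ) • PA x) x, Plane.proj_smul hBconv hBcone hPB ht, smul_add, smul_sub]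
  · intro x y
    have h1 := Plane.proj_firm hAconv hPA x y
    have h2 := Plane.proj_firm hBconv hPB ((2 : ℝ) • PA x - x) ((2 : ℝ) • PA y - y)
    rw [hT', hT']
    simp only [Plane.inner_eq, Plane.norm_sq_eq, PiLp.sub_apply, PiLp.add_apply,
      PiLp.smul_apply, smul_eq_mul] at *
    nlinarith
  · rw [hT', hPAc, two_smul, add_sub_cancel_right, hPBc, sub_self, zero_add]
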